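/- Let Γ: ℝ → ℝ^{d+1} (d ≥ 1) be a normalized nondegenerate curve. Let a₁ ∈ ℝ be a constant, a₀: ℝ → ℝ smooth, and let Γ̃: ℝ × (−δ, δ) → ℝ^{d+1} be a smooth family with Γ̃(x, 0) = Γ(x) and ∂_ε Γ̃(x, 0) = a₀(x) Γ(x) + a₁ Γ′(x) for all x. If det(Γ̃(x,ε), ∂_x Γ̃(x,ε), …, ∂_x^d Γ̃(x,ε)) = 1 for all x and ε, then a₀(x) = 0 for all x ∈ ℝ. -/

import Mathlib

/-- The determinant of the `n × n` matrix with columns `v 0, …, v (n-1)`. -/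
noncomputable def detCols {n : ℕ} (v : Fin n → (Fin n → ℝ)) : ℝ :=
  Matrix.det (Matrix.of fun i j => v j i)

open Set

section PartialDerivatives

variable {E : Type*} [NormedAddCommGroup E] [NormedSpace ℝ E]

theorem hasDerivAt_fst_of_differentiableAt {F : ℝ → ℝ → E} {x t : ℝ}
    (h : DifferentiableAt ℝ (fun p : ℝ × ℝ => F p.1 p.2) (x, t)) :
    HasDerivAt (fun y => F y t) (fderiv ℝ (fun p : ℝ × ℝ => F p.1 p.2) (x, t) (1, 0)) x :=
  h.hasFDerivAt.comp_hasDerivAt (f := fun y : ℝ => (y, t)) x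
    ((hasDerivAt_id x).prodMk (hasDerivAt_const x t))

theorem hasDerivAt_snd_of_differentiableAt {F : ℝ → ℝ → E} {x t : ℝ}
    (h : DifferentiableAt ℝ (fun p : ℝ × ℝ => F p.1 p.2) (x, t)) :
    HasDerivAt (fun s => F x s) (fderiv ℝ (fun p : ℝ × ℝ => F p.1 p.2) (x, t) (0, 1)) t :=
  h.hasFDerivAt.comp_hasDerivAt (f := fun s : ℝ => (x, s)) t
    ((hasDerivAt_const t x).prodMk (hasDerivAt_id t))

variable {F : ℝ → ℝ → E} {S : Set ℝ}

theorem contDiffAt_of_contDiffOn_univ_prod (hS : IsOpen S)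
    (hF : ContDiffOn ℝ (⊤ : ℕ∞) (fun p : ℝ × ℝ => F p.1 p.2) (univ ×ˢ S))
    (x : ℝ) {t : ℝ} (ht : t ∈ S) :
    ContDiffAt ℝ (⊤ : ℕ∞) (fun p : ℝ × ℝ => F p.1 p.2) (x, t) :=
  hF.contDiffAt ((isOpen_univ.prod hS).mem_nhds ⟨mem_univ _, ht⟩)

theorem differentiableAt_of_contDiffOn_univ_prod (hS : IsOpen S)
    (hF : ContDiffOn ℝ (⊤ : ℕ∞) (fun p : ℝ × ℝ => F p.1 p.2) (univ ×ˢ S))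
    (x : ℝ) {t : ℝ} (ht : t ∈ S) :
    DifferentiableAt ℝ (fun p : ℝ × ℝ => F p.1 p.2) (x, t) :=
  (contDiffAt_of_contDiffOn_univ_prod hS hF x ht).differentiableAt (by simp)

theorem contDiffOn_deriv_fst (hS : IsOpen S)
    (hF : ContDiffOn ℝ (⊤ : ℕ∞) (fun p : ℝ × ℝ => F p.1 p.2) (univ ×ˢ S)) :
    ContDiffOn ℝ (⊤ : ℕ∞) (fun p : ℝ × ℝ => deriv (fun y => F y p.2) p.1) (univ ×ˢ S) := by
  have h := (hF.fderiv_of_isOpen (m := (⊤ : ℕ∞)) (isOpen_univ.prod hS) (by simp)).clm_apply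
    (contDiffOn_const (c := ((1 : ℝ), (0 : ℝ))))
  refine h.congr fun p hp => ?_
  exact (hasDerivAt_fst_of_differentiableAt
    (differentiableAt_of_contDiffOn_univ_prod hS hF p.1 hp.2)).deriv

theorem contDiffOn_iteratedDeriv_fst (hS : IsOpen S)
    (hF : ContDiffOn ℝ (⊤ : ℕ∞) (fun p : ℝ × ℝ => F p.1 p.2) (univ ×ˢ S)) (i : ℕ) :
    ContDiffOn ℝ (⊤ : ℕ∞) (fun p : ℝ × ℝ => iteratedDeriv i (fun y => F y p.2) p.1)
      (univ ×ˢ S) := by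
  induction i with
  | zero => simpa only [iteratedDeriv_zero] using hF
  | succ i ih =>
    simp only [iteratedDeriv_succ]
    exact contDiffOn_deriv_fst (F := fun x t => iteratedDeriv i (fun y => F y t) x) hS ih

theorem deriv_deriv_swap (hS : IsOpen S)
    (hF : ContDiffOn ℝ (⊤ : ℕ∞) (fun p : ℝ × ℝ => F p.1 p.2) (univ ×ˢ S))
    (x : ℝ) {t : ℝ} (ht : t ∈ S) :
    deriv (fun s => deriv (fun y => F y s) x) t = deriv (fun y => deriv (fun s => F y s) t) x := by
  have hd := fun (x : ℝ) {t : ℝ} (ht : t ∈ S) =>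
    differentiableAt_of_contDiffOn_univ_prod hS hF x ht
  have hF' : DifferentiableAt ℝ (fderiv ℝ (fun p : ℝ × ℝ => F p.1 p.2)) (x, t) :=
    ((contDiffAt_of_contDiffOn_univ_prod hS hF x ht).fderiv_right (m := 1)
      (by norm_cast)).differentiableAt (by simp)
  have hsymm : IsSymmSndFDerivAt ℝ (fun p : ℝ × ℝ => F p.1 p.2) (x, t) :=
    (contDiffAt_of_contDiffOn_univ_prod hS hF x ht).isSymmSndFDerivAt
      (by simp only [minSmoothness_of_isRCLikeNormedField]; norm_cast)
  have h₁ : deriv (fun s => deriv (fun y => F y s) x) t =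
      fderiv ℝ (fderiv ℝ (fun p : ℝ × ℝ => F p.1 p.2)) (x, t) (0, 1) (1, 0) := by
    have hev : (fun s => deriv (fun y => F y s) x) =ᶠ[nhds t]
        fun s => fderiv ℝ (fun p : ℝ × ℝ => F p.1 p.2) (x, s) (1, 0) := by
      filter_upwards [hS.mem_nhds ht] with s hs
      exact (hasDerivAt_fst_of_differentiableAt (hd x hs)).deriv
    rw [hev.deriv_eq]
    have h := hasDerivAt_snd_of_differentiableAt
      (F := fun y s => fderiv ℝ (fun p : ℝ × ℝ => F p.1 p.2) (y, s)) hF'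
    simpa using (h.clm_apply (hasDerivAt_const t ((1 : ℝ), (0 : ℝ)))).deriv
  have h₂ : deriv (fun y => deriv (fun s => F y s) t) x =
      fderiv ℝ (fderiv ℝ (fun p : ℝ × ℝ => F p.1 p.2)) (x, t) (1, 0) (0, 1) := by
    have hev : (fun y => deriv (fun s => F y s) t) =
        fun y => fderiv ℝ (fun p : ℝ × ℝ => F p.1 p.2) (y, t) (0, 1) :=
      funext fun y => (hasDerivAt_snd_of_differentiableAt (hd y ht)).deriv
    rw [hev]
    have h := hasDerivAt_fst_of_differentiableAt
      (F := fun y s => fderiv ℝ (fun p : ℝ × ℝ => F p.1 p.2) (y, s)) hF'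
    simpa using (h.clm_apply (hasDerivAt_const x ((0 : ℝ), (1 : ℝ)))).deriv
  rw [h₁, h₂, hsymm.eq]

theorem hasDerivAt_iteratedDeriv_fst (hS : IsOpen S)
    (hF : ContDiffOn ℝ (⊤ : ℕ∞) (fun p : ℝ × ℝ => F p.1 p.2) (univ ×ˢ S))
    (i : ℕ) (x : ℝ) {t : ℝ} (ht : t ∈ S) :
    HasDerivAt (fun s => iteratedDeriv i (fun y => F y s) x)
      (iteratedDeriv i (fun y => deriv (fun s => F y s) t) x) t := by
  have hG := contDiffOn_iteratedDeriv_fst hS hF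
  suffices h : deriv (fun s => iteratedDeriv i (fun y => F y s) x) t =
      iteratedDeriv i (fun y => deriv (fun s => F y s) t) x by
    rw [← h]
    exact (hasDerivAt_snd_of_differentiableAt
      (F := fun x s => iteratedDeriv i (fun y => F y s) x)
      (differentiableAt_of_contDiffOn_univ_prod
        (F := fun x s => iteratedDeriv i (fun y => F y s) x)
        hS (hG i) x ht)).differentiableAt.hasDerivAt
  induction i generalizing x with
  | zero => simp only [iteratedDeriv_zero]
  | succ i ih =>
    simp only [iteratedDeriv_succ]
    rw [deriv_deriv_swap (F := fun x s => iteratedDeriv i (fun y => F y s) x) hS (hG i) x ht]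
    exact congrArg (fun f => deriv f x) (funext ih)

theorem iteratedDeriv_smul_sub_mem_span {a : ℝ → ℝ} {f : ℝ → E}
    (ha : ContDiff ℝ (⊤ : ℕ∞) a) (hf : ContDiff ℝ (⊤ : ℕ∞) f) (i : ℕ) (x : ℝ) :
    iteratedDeriv i (fun y => a y • f y) x - a x • iteratedDeriv i f x ∈
      Submodule.span ℝ ((fun k => iteratedDeriv k f x) '' Iio i) := by
  induction i generalizing a f with
  | zero => simp
  | succ i ih =>
    have ha' : ContDiff ℝ (⊤ : ℕ∞) (deriv a) := (contDiff_infty_iff_deriv.1 ha).2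
    have hf' : ContDiff ℝ (⊤ : ℕ∞) (deriv f) := (contDiff_infty_iff_deriv.1 hf).2
    have hderiv : deriv (fun y => a y • f y) =
        a • deriv f + deriv a • f := by
      funext y
      exact deriv_fun_smul (ha.differentiable (by simp) y) (hf.differentiable (by simp) y)
    have hle : ∀ {g : ℝ → E}, ContDiff ℝ (⊤ : ℕ∞) g → ContDiffAt ℝ i g x := fun hg =>
      (hg.of_le (by exact_mod_cast le_top)).contDiffAt
    rw [iteratedDeriv_succ', hderiv, iteratedDeriv_add (hle (ha.smul hf')) (hle (ha'.smul hf)),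
      iteratedDeriv_succ', add_sub_right_comm]
    refine add_mem (Submodule.span_mono ?_ (ih ha hf')) ?_
    · rintro _ ⟨k, hk, rfl⟩
      exact ⟨k + 1, by simpa using hk, by simp only [iteratedDeriv_succ']⟩
    · rw [← sub_add_cancel (iteratedDeriv i (deriv a • f) x)
        (deriv a x • iteratedDeriv i f x)]
      refine add_mem (Submodule.span_mono (image_mono (Iio_subset_Iio i.le_succ)) (ih ha' hf)) ?_
      exact Submodule.smul_mem _ _ (Submodule.subset_span ⟨i, Nat.lt_succ_self i, rfl⟩)

end PartialDerivatives

section Determinant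

variable {n : ℕ}

/-- `detCols` as a continuous alternating map of the columns. -/
noncomputable def detColsAlternating (n : ℕ) : (Fin n → ℝ) [⋀^Fin n]→L[ℝ] ℝ where
  toAlternatingMap := Matrix.detRowAlternating
  cont := Continuous.matrix_det continuous_id

theorem detColsAlternating_apply (v : Fin n → Fin n → ℝ) :
    detColsAlternating n v = detCols v :=
  (Matrix.det_transpose (Matrix.of v)).symm

theorem sum_detColsAlternating_update_eq_zero {v : ℝ → Fin n → Fin n → ℝ} {w : Fin n → Fin n → ℝ}
    {t c : ℝ} (hv : ∀ i, HasDerivAt (fun s => v s i) (w i) t)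
    (hc : ∀ᶠ s in nhds t, detCols (v s) = c) :
    ∑ i, detColsAlternating n (Function.update (v t) i (w i)) = 0 := by
  have h := ((detColsAlternating n).hasFDerivAt (v t)).comp_hasDerivAt t (hasDerivAt_pi.2 hv)
  rw [ContinuousMultilinearMap.linearDeriv_apply] at h
  refine h.unique ((hasDerivAt_const t c).congr_of_eventuallyEq ?_)
  filter_upwards [hc] with s hs
  exact (detColsAlternating_apply (v s)).trans hs

theorem detColsAlternating_update_eq_zero_of_mem_span (v : Fin n → Fin n → ℝ) (i : Fin n)
    {u : Fin n → ℝ} (hu : u ∈ Submodule.span ℝ (v '' {i}ᶜ)) :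
    detColsAlternating n (Function.update v i u) = 0 := by
  induction hu using Submodule.span_induction with
  | mem x hx =>
    obtain ⟨j, hj, rfl⟩ := hx
    exact (detColsAlternating n).map_eq_zero_of_eq (i := i) (j := j) _
      (by rw [Function.update_self, Function.update_of_ne hj]) (Ne.symm hj)
  | zero => exact (detColsAlternating n).map_coord_zero i (by simp)
  | add x y _ _ hx hy => rw [ContinuousAlternatingMap.map_update_add, hx, hy, add_zero]
  | smul r x _ hx => rw [ContinuousAlternatingMap.map_update_smul, hx, smul_zero]

end Determinant

/-- If a smooth family `Γ̃` through a normalized nondegenerate curve `Γ` has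
`∂_ε Γ̃(x,0) = a₀(x) Γ(x) + a₁ Γ'(x)` (with `a₁` constant), and each curve `Γ̃(·,ε)`
is normalized, then `a₀ ≡ 0`. -/
theorem stmt11 (d : ℕ) (hd : 1 ≤ d) (Γ : ℝ → (Fin (d+1) → ℝ)) (hΓ : ContDiff ℝ (⊤ : ℕ∞) Γ)
    (hdet : ∀ x : ℝ, detCols (fun i : Fin (d+1) => iteratedDeriv (i : ℕ) Γ x) = 1)
    (a₁ : ℝ) (a₀ : ℝ → ℝ) (ha₀ : ContDiff ℝ (⊤ : ℕ∞) a₀)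
    (δ : ℝ) (hδ : 0 < δ)
    (Γt : ℝ → ℝ → (Fin (d+1) → ℝ))
    (hΓt : ContDiffOn ℝ (⊤ : ℕ∞) (fun p : ℝ × ℝ => Γt p.1 p.2) (Set.univ ×ˢ Set.Ioo (-δ) δ))
    (h0 : ∀ x : ℝ, Γt x 0 = Γ x)
    (h1 : ∀ x : ℝ, deriv (fun ε => Γt x ε) 0 = a₀ x • Γ x + a₁ • deriv Γ x)
    (hdet' : ∀ x : ℝ, ∀ ε ∈ Set.Ioo (-δ) δ,
      detCols (fun i : Fin (d+1) => iteratedDeriv (i : ℕ) (fun y => Γt y ε) x) = 1) :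
    ∀ x : ℝ, a₀ x = 0 := by
  intro x
  set D := detColsAlternating (d + 1)
  set v : Fin (d + 1) → Fin (d + 1) → ℝ := fun i => iteratedDeriv (i : ℕ) Γ x
  have hΓ' : ContDiff ℝ (⊤ : ℕ∞) (deriv Γ) := (contDiff_infty_iff_deriv.1 hΓ).2
  have hDv : D v = 1 := (detColsAlternating_apply v).trans (hdet x)
  have hzero : (0 : ℝ) ∈ Set.Ioo (-δ) δ := ⟨neg_lt_zero.2 hδ, hδ⟩
  have hshift : ∑ i, D (Function.update v i (iteratedDeriv ((i : ℕ) + 1) Γ x)) = 0 := by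
    refine sum_detColsAlternating_update_eq_zero
      (v := fun y (i : Fin (d + 1)) => iteratedDeriv (i : ℕ) Γ y) (c := 1) (fun i => ?_)
      (Filter.Eventually.of_forall hdet)
    rw [iteratedDeriv_succ]
    exact ((hΓ.differentiable_iteratedDeriv i (by exact_mod_cast ENat.natCast_lt_top _)) x).hasDerivAt
  have hvar : ∑ i : Fin (d + 1), D (Function.update v i
      (iteratedDeriv (i : ℕ) (fun y => a₀ y • Γ y + a₁ • deriv Γ y) x)) = 0 := by
    have h := sum_detColsAlternating_update_eq_zero (t := 0) (c := 1)
      (v := fun ε (i : Fin (d + 1)) => iteratedDeriv (i : ℕ) (fun y => Γt y ε) x)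
      (fun i => hasDerivAt_iteratedDeriv_fst isOpen_Ioo hΓt i x hzero)
      (Filter.mem_of_superset (isOpen_Ioo.mem_nhds hzero) fun ε hε => hdet' x ε hε)
    simpa only [h0, h1] using h
  have hterm : ∀ i : Fin (d + 1), D (Function.update v i
      (iteratedDeriv (i : ℕ) (fun y => a₀ y • Γ y + a₁ • deriv Γ y) x)) =
      a₀ x + a₁ * D (Function.update v i (iteratedDeriv ((i : ℕ) + 1) Γ x)) := by
    intro i
    have hle : ∀ {g : ℝ → Fin (d + 1) → ℝ}, ContDiff ℝ (⊤ : ℕ∞) g →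
        ContDiffAt ℝ (i : ℕ) g x := fun hg => (hg.of_le (by exact_mod_cast le_top)).contDiffAt
    have hspan : iteratedDeriv (i : ℕ) (fun y => a₀ y • Γ y) x - a₀ x • v i ∈
        Submodule.span ℝ (v '' {i}ᶜ) := by
      refine Submodule.span_mono ?_ (iteratedDeriv_smul_sub_mem_span ha₀ hΓ i x)
      rintro _ ⟨k, hk, rfl⟩
      exact ⟨⟨k, lt_trans hk i.2⟩, fun h => hk.ne (congrArg Fin.val h), rfl⟩
    have hsplit : iteratedDeriv (i : ℕ) (fun y => a₀ y • Γ y + a₁ • deriv Γ y) x =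
        (iteratedDeriv (i : ℕ) (fun y => a₀ y • Γ y) x - a₀ x • v i) + a₀ x • v i +
          a₁ • iteratedDeriv ((i : ℕ) + 1) Γ x := by
      rw [sub_add_cancel, iteratedDeriv_succ', ← iteratedDeriv_const_smul (hle hΓ') a₁]
      exact iteratedDeriv_add (hle (ha₀.smul hΓ)) (hle (hΓ'.const_smul a₁))
    rw [hsplit, ContinuousAlternatingMap.map_update_add, ContinuousAlternatingMap.map_update_add,
      ContinuousAlternatingMap.map_update_smul, ContinuousAlternatingMap.map_update_smul,
      detColsAlternating_update_eq_zero_of_mem_span v i hspan, Function.update_eq_self, hDv]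
    simp
  simp only [hterm, Finset.sum_add_distrib, ← Finset.mul_sum, hshift] at hvar
  have hd' : ((d : ℝ) + 1) * a₀ x = 0 := by simpa using hvar
  exact (mul_eq_zero.1 hd').resolve_left (by positivity)
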